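/- arXiv:2101.06026 — 5 statements merged into one kernel-verified Lean document; each statement's English description precedes it below -/
import Mathlib

section
/- For all integers n and k with 0 ≤ k < n, the pair of statistics (inv, lmax) and the pair (DIS, cyc) have the same joint distribution over A(n,k); that is, for all integers a, b ≥ 0, the number of permutations σ ∈ A(n,k) with inv(σ) = a and lmax(σ) = b equals the number of permutations σ ∈ A(n,k) with DIS(σ) = a and cyc(σ) = b. -/
attribute [local instance] Classical.propDecidable

/-- The maximum drop size of a permutation (0-indexed positions and values). -/
def maxdrop {n : ℕ} (π : Equiv.Perm (Fin n)) : ℕ :=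
  Finset.univ.sup fun i : Fin n => (i : ℕ) - (π i : ℕ)

/-- `A(n,k)`: permutations of `[n]` with maximum drop size at most `k`. -/
def bddA (n k : ℕ) : Finset (Equiv.Perm (Fin n)) :=
  Finset.univ.filter fun π => maxdrop π ≤ k

/-- `S(n,k)`: permutations of `[n]` with `σ i - i ≤ k` for all `i`. -/
def bddS (n k : ℕ) : Finset (Equiv.Perm (Fin n)) :=
  Finset.univ.filter fun π => ∀ i : Fin n, (π i : ℕ) ≤ (i : ℕ) + k

/-- The number of inversions of a permutation. -/
def invStat {n : ℕ} (π : Equiv.Perm (Fin n)) : ℕ :=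
  (Finset.univ.filter fun p : Fin n × Fin n => p.1 < p.2 ∧ π p.2 < π p.1).card

/-- The number of left-to-right maxima of a permutation. -/
def lmaxStat {n : ℕ} (π : Equiv.Perm (Fin n)) : ℕ :=
  (Finset.univ.filter fun i : Fin n => ∀ j, j < i → π j < π i).card

/-- The number of cycles of a permutation, fixed points included. -/
def cycStat {n : ℕ} (π : Equiv.Perm (Fin n)) : ℕ :=
  π.cycleType.card + (Finset.univ.filter fun i => π i = i).card

/-- The sorting index: `σ` has a unique factorization
`σ = (i₁,j₁)(i₂,j₂)⋯(iₘ,jₘ)` into transpositions with `j₁ < j₂ < ⋯ < jₘ` and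
`iᵣ < jᵣ` for all `r`, and `sor σ = Σᵣ (jᵣ - iᵣ)`. -/
noncomputable def sorStat {n : ℕ} (σ : Equiv.Perm (Fin n)) : ℕ :=
  if h : ∃ l : List (Fin n × Fin n),
      (∀ p ∈ l, p.1 < p.2) ∧ l.Chain' (fun p q => p.2 < q.2) ∧
      σ = (l.map fun p => Equiv.swap p.1 p.2).prod
  then (h.choose.map fun p => (p.2 : ℕ) - (p.1 : ℕ)).sum
  else 0

/-- `DIS σ = sor σ⁻¹`. -/
noncomputable def DIS {n : ℕ} (σ : Equiv.Perm (Fin n)) : ℕ := sorStat σ⁻¹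

/-- 213-avoiding permutations: no `i < j < l` with `π j < π i < π l`. -/
def avoids213 {n : ℕ} (π : Equiv.Perm (Fin n)) : Prop :=
  ¬ ∃ i j l : Fin n, i < j ∧ j < l ∧ π j < π i ∧ π i < π l

/-- 132-avoiding permutations: no `i < j < l` with `π i < π l < π j`. -/
def avoids132 {n : ℕ} (π : Equiv.Perm (Fin n)) : Prop :=
  ¬ ∃ i j l : Fin n, i < j ∧ j < l ∧ π i < π l ∧ π l < π j

/-- 321-avoiding permutations: no `i < j < l` with `π i > π j > π l`. -/
def avoids321 {n : ℕ} (π : Equiv.Perm (Fin n)) : Prop :=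
  ¬ ∃ i j l : Fin n, i < j ∧ j < l ∧ π l < π j ∧ π j < π i

/-- The number of descents of a permutation. -/
def desStat {n : ℕ} (π : Equiv.Perm (Fin n)) : ℕ :=
  (Finset.univ.filter fun i : Fin n =>
    ∃ j : Fin n, (j : ℕ) = (i : ℕ) + 1 ∧ π j < π i).card

/-- The number of right-to-left maxima of a permutation. -/
def rmaxStat {n : ℕ} (π : Equiv.Perm (Fin n)) : ℕ :=
  (Finset.univ.filter fun i : Fin n => ∀ j, i < j → π j < π i).card

/-- The number of non-weak excedances before the last position. -/
def vnwStat {N : ℕ} (π : Equiv.Perm (Fin N)) : ℕ :=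
  (Finset.univ.filter fun i : Fin N => (i : ℕ) + 1 < N ∧ (π i : ℕ) < (i : ℕ)).card

/-- `Γ_{n,k}`: sequences of `n` ones (`true`) and `k` negative ones (`false`)
with all partial sums nonnegative. -/
noncomputable def GammaBP (n k : ℕ) : Finset (Fin (n + k) → Bool) :=
  Finset.univ.filter fun a =>
    (Finset.univ.filter fun i => a i = true).card = n ∧
    ∀ m ∈ Finset.range (n + k + 1),
      (Finset.univ.filter fun i : Fin (n + k) => (i : ℕ) < m ∧ a i = false).card ≤
      (Finset.univ.filter fun i : Fin (n + k) => (i : ℕ) < m ∧ a i = true).card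

/-- `vpk a`: the number of ones immediately followed by a `-1` that are not the
rightmost one. -/
def vpkStat {N : ℕ} (a : Fin N → Bool) : ℕ :=
  (Finset.univ.filter fun i : Fin N =>
    a i = true ∧ (∃ j : Fin N, (j : ℕ) = (i : ℕ) + 1 ∧ a j = false) ∧
    ∃ j : Fin N, i < j ∧ a j = true).card

/-- `Γ^u_{n,k}`: elements of `Γ_{n,k}` ending with a one. -/
noncomputable def GammaBPU (n k : ℕ) : Finset (Fin (n + k) → Bool) :=
  (GammaBP n k).filter fun a => ∀ i : Fin (n + k), (i : ℕ) + 1 = n + k → a i = true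

/-- `Γ^d_{n,k}`: elements of `Γ_{n,k}` ending with a negative one. -/
noncomputable def GammaBPD (n k : ℕ) : Finset (Fin (n + k) → Bool) :=
  (GammaBP n k).filter fun a => ∀ i : Fin (n + k), (i : ℕ) + 1 = n + k → a i = false

/-- The transposition `t_{i,j}` of `1`-based positions `i` and `j`. -/
def transp (n i j : ℕ) : Equiv.Perm (Fin n) :=
  if h : i - 1 < n ∧ j - 1 < n then Equiv.swap ⟨i - 1, h.1⟩ ⟨j - 1, h.2⟩ else 1

/-- `Ψ_{i,k} = 1 + sᵢ + sᵢsᵢ₋₁ + ⋯` (with `min i k + 1` terms) in `ℤ[Sₙ]`,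
where `sᵢ = (i, i+1)` (1-based). -/
noncomputable def PsiElt (n k i : ℕ) : MonoidAlgebra ℤ (Equiv.Perm (Fin n)) :=
  ∑ m ∈ Finset.range (min i k + 1),
    MonoidAlgebra.of ℤ (Equiv.Perm (Fin n))
      (((List.range m).map fun r => transp n (i - r) (i - r + 1)).prod)

/-- `Φ_{i,k} = 1 + t_{i,i+1} + t_{i-1,i+1} + ⋯` (with `min i k + 1` terms)
in `ℤ[Sₙ]`. -/
noncomputable def PhiElt (n k i : ℕ) : MonoidAlgebra ℤ (Equiv.Perm (Fin n)) :=
  ∑ m ∈ Finset.range (min i k + 1),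
    MonoidAlgebra.of ℤ (Equiv.Perm (Fin n)) (transp n (i + 1 - m) (i + 1))

/-- `[i]_q = 1 + q + ⋯ + q^{i-1}` as an element of `ℤ[q,t]`
(with `q = X 0`, `t = X 1`). -/
noncomputable def qBracket (i : ℕ) : MvPolynomial (Fin 2) ℤ :=
  ∑ j ∈ Finset.range i, MvPolynomial.X 0 ^ j

/-! ### Helper material -/

/-- Append the value `i` at the last position, shifting larger values up. -/
def insLast {n : ℕ} (i : Fin (n + 1)) (π : Equiv.Perm (Fin n)) : Equiv.Perm (Fin (n + 1)) :=
  ((finSuccEquiv' (Fin.last n)).trans (Equiv.optionCongr π)).trans (finSuccEquiv' i).symm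

theorem insLast_last {n : ℕ} (i : Fin (n + 1)) (π : Equiv.Perm (Fin n)) :
    insLast i π (Fin.last n) = i := by
  simp [insLast]

theorem insLast_castSucc {n : ℕ} (i : Fin (n + 1)) (π : Equiv.Perm (Fin n)) (j : Fin n) :
    insLast i π j.castSucc = i.succAbove (π j) := by
  have h : finSuccEquiv' (Fin.last n) j.castSucc = some j :=
    finSuccEquiv'_last_apply_castSucc j
  simp [insLast, h]

/-- Multiply on the left by the transposition of `i` and the last element. -/
noncomputable def swpLast {n : ℕ} (i : Fin (n + 1)) (π : Equiv.Perm (Fin n)) :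
    Equiv.Perm (Fin (n + 1)) :=
  Equiv.swap i (Fin.last n) * insLast (Fin.last n) π

theorem swpLast_last {n : ℕ} (i : Fin (n + 1)) (π : Equiv.Perm (Fin n)) :
    swpLast i π (Fin.last n) = i := by
  simp [swpLast, insLast_last]

theorem swpLast_castSucc {n : ℕ} (i : Fin (n + 1)) (π : Equiv.Perm (Fin n)) (j : Fin n) :
    swpLast i π j.castSucc = if (π j).castSucc = i then Fin.last n else (π j).castSucc := by
  simp only [swpLast, Equiv.Perm.mul_apply, insLast_castSucc, Fin.succAbove_last,
    Equiv.swap_apply_def]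
  have : (π j).castSucc ≠ Fin.last n := (Fin.castSucc_lt_last _).ne
  simp [this]

theorem insLast_inj {n : ℕ} {i i' : Fin (n + 1)} {π π' : Equiv.Perm (Fin n)}
    (h : insLast i π = insLast i' π') : i = i' ∧ π = π' := by
  have h1 : i = i' := by
    rw [← insLast_last i π, h, insLast_last]
  subst h1
  refine ⟨rfl, ?_⟩
  ext j : 1
  have := insLast_castSucc i π j
  rw [h, insLast_castSucc] at this
  exact (Fin.succAbove_right_injective this).symm

theorem swpLast_inj {n : ℕ} {i i' : Fin (n + 1)} {π π' : Equiv.Perm (Fin n)}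
    (h : swpLast i π = swpLast i' π') : i = i' ∧ π = π' := by
  have h1 : i = i' := by
    rw [← swpLast_last i π, h, swpLast_last]
  subst h1
  exact ⟨rfl, (insLast_inj (mul_left_cancel h)).2⟩

theorem insLast_bij (n : ℕ) : Function.Bijective
    (fun p : Fin (n + 1) × Equiv.Perm (Fin n) => insLast p.1 p.2) := by
  rw [Fintype.bijective_iff_injective_and_card]
  refine ⟨fun p q h => Prod.ext (insLast_inj h).1 (insLast_inj h).2, ?_⟩
  simp [Fintype.card_perm, Nat.factorial_succ]

theorem swpLast_bij (n : ℕ) : Function.Bijective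
    (fun p : Fin (n + 1) × Equiv.Perm (Fin n) => swpLast p.1 p.2) := by
  rw [Fintype.bijective_iff_injective_and_card]
  refine ⟨fun p q h => Prod.ext (swpLast_inj h).1 (swpLast_inj h).2, ?_⟩
  simp [Fintype.card_perm, Nat.factorial_succ]

theorem maxdrop_le_iff {n k : ℕ} (π : Equiv.Perm (Fin n)) :
    maxdrop π ≤ k ↔ ∀ i : Fin n, (i : ℕ) ≤ (π i : ℕ) + k := by
  simp only [maxdrop, Finset.sup_le_iff, Finset.mem_univ, true_implies]
  exact forall_congr' fun i => by omega

theorem maxdrop_insLast {n k : ℕ} (i : Fin (n + 1)) (π : Equiv.Perm (Fin n)) :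
    maxdrop (insLast i π) ≤ k ↔ n ≤ (i : ℕ) + k ∧ maxdrop π ≤ k := by
  simp only [maxdrop_le_iff, Fin.forall_fin_succ', insLast_last, insLast_castSucc,
    Fin.val_castSucc, Fin.val_last]
  rw [and_comm]
  refine and_congr_right fun hi => forall_congr' fun j => ?_
  have := j.2
  simp only [Fin.succAbove, Fin.lt_def]
  split_ifs with h <;> simp at h ⊢ <;> omega

theorem maxdrop_swpLast {n k : ℕ} (i : Fin (n + 1)) (π : Equiv.Perm (Fin n)) :
    maxdrop (swpLast i π) ≤ k ↔ n ≤ (i : ℕ) + k ∧ maxdrop π ≤ k := by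
  simp only [maxdrop_le_iff, Fin.forall_fin_succ', swpLast_last, swpLast_castSucc,
    Fin.val_castSucc, Fin.val_last]
  rw [and_comm]
  refine and_congr_right fun hi => forall_congr' fun j => ?_
  have := j.2
  split_ifs with h
  · subst h
    simp at hi ⊢
    omega
  · simp

theorem card_ge_aux {n : ℕ} (i : Fin (n + 1)) :
    (Finset.univ.filter fun v : Fin n => (i : ℕ) ≤ (v : ℕ)).card = n - i := by
  have h : (Finset.univ.filter fun v : Fin n => (i : ℕ) ≤ (v : ℕ)).card
      = (Finset.Ico (i : ℕ) n).card := by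
    refine Finset.card_bij (fun v _ => (v : ℕ)) ?_ ?_ ?_
    · intro v hv
      simp at hv ⊢
      exact hv
    · intro v _ w _ h
      exact Fin.ext h
    · intro b hb
      simp at hb
      exact ⟨⟨b, hb.2⟩, by simpa using hb.1, rfl⟩
  rw [h, Nat.card_Ico]

theorem inv_insLast {n : ℕ} (i : Fin (n + 1)) (π : Equiv.Perm (Fin n)) :
    invStat (insLast i π) = invStat π + (n - i) := by
  rw [← card_ge_aux i]
  have h2 : (Finset.univ.filter fun v : Fin n => (i : ℕ) ≤ (v : ℕ)).card
      = (Finset.univ.filter fun j : Fin n => (i : ℕ) ≤ (π j : ℕ)).card := by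
    symm
    refine Finset.card_bij (fun v _ => π v) ?_ ?_ ?_
    · intro v hv
      simpa using hv
    · intro v _ w _ h
      exact π.injective h
    · intro b hb
      exact ⟨π.symm b, by simpa using hb, by simp⟩
  rw [h2]
  simp only [invStat, Finset.card_filter, ← Finset.univ_product_univ, Finset.sum_product,
    Fin.sum_univ_castSucc, insLast_last, insLast_castSucc, Fin.castSucc_lt_castSucc_iff,
    Fin.castSucc_lt_last, Fin.succAbove_lt_succAbove_iff, lt_irrefl, false_and, if_false, true_and]
  have h3 : ∀ x : Fin n, ¬ (Fin.last n < x.castSucc) := fun x => not_lt.2 (Fin.le_last _)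
  simp only [h3, false_and, if_false, Finset.sum_const_zero, add_zero, Finset.sum_add_distrib]
  congr 1
  refine Finset.sum_congr rfl fun j _ => ?_
  have : i < i.succAbove (π j) ↔ (i : ℕ) ≤ (π j : ℕ) := by
    rw [Fin.lt_succAbove_iff_le_castSucc, Fin.le_def]; simp
  simp only [this]

theorem lmax_insLast {n : ℕ} (i : Fin (n + 1)) (π : Equiv.Perm (Fin n)) :
    lmaxStat (insLast i π) = lmaxStat π + (if i = Fin.last n then 1 else 0) := by
  have h3 : ∀ x : Fin n, ¬ (Fin.last n < x.castSucc) := fun x => not_lt.2 (Fin.le_last _)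
  have h4 : (∀ x : Fin n, i.succAbove (π x) < i) ↔ i = Fin.last n := by
    constructor
    · intro h
      by_contra hi
      have hi' : (i : ℕ) < n := by
        have := i.2
        have : (i : ℕ) ≠ n := fun h => hi (Fin.ext h)
        omega
      have := h (π.symm ⟨i, hi'⟩)
      rw [Equiv.apply_symm_apply, Fin.succAbove_lt_iff_castSucc_lt, Fin.lt_def] at this
      simp at this
    · rintro rfl x
      simp [Fin.castSucc_lt_last]
  simp only [lmaxStat, Finset.card_filter, Fin.sum_univ_castSucc, Fin.forall_fin_succ',
    insLast_last, insLast_castSucc, Fin.castSucc_lt_castSucc_iff, h3,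
    Fin.castSucc_lt_last, Fin.succAbove_lt_succAbove_iff, lt_irrefl, false_implies, and_true,
    true_implies, h4]

theorem cyc_swap_aux {α : Type*} [Fintype α] [DecidableEq α] (f : Equiv.Perm α) (x y : α)
    (hy : f y = y) (hxy : x ≠ y) :
    (Equiv.swap x y * f).cycleType.card +
      (Finset.univ.filter fun z => (Equiv.swap x y * f) z = z).card + 1 =
    f.cycleType.card + (Finset.univ.filter fun z => f z = z).card := by
  by_cases hx : f x = x
  · have hd : Equiv.Perm.Disjoint (Equiv.swap x y) f := by
      intro z
      by_cases h1 : z = x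
      · right; rw [h1, hx]
      by_cases h2 : z = y
      · right; rw [h2, hy]
      left; exact Equiv.swap_apply_of_ne_of_ne h1 h2
    have hs : (Equiv.swap x y).cycleType.card = 1 :=
      Equiv.Perm.card_cycleType_eq_one.2 (Equiv.Perm.isCycle_swap hxy)
    have hf : (Finset.univ.filter fun z => f z = z) =
        insert x (insert y (Finset.univ.filter fun z => (Equiv.swap x y * f) z = z)) := by
      ext z
      simp only [Finset.mem_filter, Finset.mem_univ, true_and, Finset.mem_insert]
      by_cases h1 : z = x
      · simp [h1, hx]
      by_cases h2 : z = y
      · simp [h2, hy]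
      simp only [h1, h2, false_or, Equiv.Perm.mul_apply]
      have h3 : f z ≠ x := fun h => h1 (f.injective (h.trans hx.symm))
      have h4 : f z ≠ y := fun h => h2 (f.injective (h.trans hy.symm))
      rw [Equiv.swap_apply_of_ne_of_ne h3 h4]
    rw [hd.cycleType_mul, Multiset.card_add, hs, hf, Finset.card_insert_of_notMem,
      Finset.card_insert_of_notMem]
    · omega
    · intro h
      have h' := (Finset.mem_filter.1 h).2
      rw [Equiv.Perm.mul_apply, hy, Equiv.swap_apply_right] at h'
      exact hxy h'
    · intro h
      have h' := (Finset.mem_filter.1 ((Finset.mem_insert.1 h).resolve_left hxy)).2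
      rw [Equiv.Perm.mul_apply, hx, Equiv.swap_apply_left] at h'
      exact hxy h'.symm
  · have hcyc : (Equiv.swap x y * f.cycleOf x).IsCycle := by
      have hm : x ∈ f.support := by simpa using hx
      have hl := Equiv.Perm.two_le_length_toList_iff_mem_support.2 hm
      have h0 := Equiv.Perm.toList_getElem_zero f x hm
      have hfp := Equiv.Perm.formPerm_toList f x
      have hnd := Equiv.Perm.nodup_toList f x
      have hny : y ∉ Equiv.Perm.toList f x := by
        rw [Equiv.Perm.mem_toList_iff]
        rintro ⟨h, -⟩
        exact hx ((h.apply_eq_self_iff).2 hy)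
      have h0' : (Equiv.Perm.toList f x)[0]? = some x := by
        rw [List.getElem?_eq_getElem (by omega), h0]
      clear h0
      generalize Equiv.Perm.toList f x = l at *
      match l, hl, h0' with
      | a :: l', hl, h0' =>
        simp at h0'
        subst h0'
        rw [← hfp, Equiv.swap_comm, ← List.formPerm_cons_cons]
        exact List.isCycle_formPerm (List.nodup_cons.2 ⟨hny, hnd⟩) (by simp)
    have hmem : f.cycleOf x ∈ f.cycleFactorsFinset :=
      Equiv.Perm.cycleOf_mem_cycleFactorsFinset_iff.2 (by simpa using hx)
    have hdis : Equiv.Perm.Disjoint (f * (f.cycleOf x)⁻¹) (f.cycleOf x) :=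
      Equiv.Perm.disjoint_mul_inv_of_mem_cycleFactorsFinset hmem
    set c := f.cycleOf x with hc
    set r := f * c⁻¹ with hr
    have hfr : f = c * r := by rw [← hdis.commute.eq, hr]; simp
    have hcx : c x = f x := Equiv.Perm.cycleOf_apply_self f x
    have hcy : c y = y := by
      rw [hc, Equiv.Perm.cycleOf_apply_of_not_sameCycle]
      intro h
      exact hx ((h.apply_eq_self_iff).2 hy)
    have hrx : r x = x := (hdis x).resolve_right (by rw [hcx]; exact hx)
    have hry : r y = y := by
      have := hy
      rw [hfr, ← hdis.commute.eq, Equiv.Perm.mul_apply, hcy] at this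
      exact this
    have hd2 : Equiv.Perm.Disjoint (Equiv.swap x y * c) r := by
      intro z
      by_cases h1 : z = x
      · right; rw [h1, hrx]
      by_cases h2 : z = y
      · right; rw [h2, hry]
      rcases hdis z with h | h
      · right; exact h
      · left; rw [Equiv.Perm.mul_apply, h, Equiv.swap_apply_of_ne_of_ne h1 h2]
    have hcc : c.IsCycle := Equiv.Perm.isCycle_cycleOf f hx
    have e1 : (Equiv.swap x y * f).cycleType.card = f.cycleType.card := by
      rw [hfr, ← mul_assoc, hd2.cycleType_mul, hdis.symm.cycleType_mul, Multiset.card_add,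
        Multiset.card_add, Equiv.Perm.card_cycleType_eq_one.2 hcyc,
        Equiv.Perm.card_cycleType_eq_one.2 hcc]
    have hf : (Finset.univ.filter fun z => f z = z) =
        insert y (Finset.univ.filter fun z => (Equiv.swap x y * f) z = z) := by
      ext z
      simp only [Finset.mem_filter, Finset.mem_univ, true_and, Finset.mem_insert]
      by_cases h2 : z = y
      · simp [h2, hy]
      simp only [h2, false_or, Equiv.Perm.mul_apply]
      have h4 : f z ≠ y := fun h => h2 (f.injective (h.trans hy.symm))
      by_cases h3 : f z = x
      · rw [h3, Equiv.swap_apply_left]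
        constructor
        · intro h; rw [← h] at h3; exact absurd h3 hx
        · intro h; exact absurd h.symm h2
      · rw [Equiv.swap_apply_of_ne_of_ne h3 h4]
    rw [e1, hf, Finset.card_insert_of_notMem]
    · omega
    · intro h
      have h' := (Finset.mem_filter.1 h).2
      rw [Equiv.Perm.mul_apply, hy, Equiv.swap_apply_right] at h'
      exact hxy h'

theorem cyc_ext {n : ℕ} (π : Equiv.Perm (Fin n)) :
    cycStat (insLast (Fin.last n) π) = cycStat π + 1 := by
  have h : insLast (Fin.last n) π =
      π.extendDomain (finSuccAboveEquiv (Fin.last n)) := by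
    ext x : 1
    refine Fin.lastCases ?_ (fun j => ?_) x
    · rw [insLast_last, Equiv.Perm.extendDomain_apply_not_subtype]
      simp
    · rw [insLast_castSucc]
      have := Equiv.Perm.extendDomain_apply_image π (finSuccAboveEquiv (Fin.last n)) j
      simp only [finSuccAboveEquiv_apply, Fin.succAbove_last] at this ⊢
      exact this.symm
  have h1 : (insLast (Fin.last n) π).cycleType = π.cycleType := by
    rw [h, Equiv.Perm.cycleType_extendDomain]
  unfold cycStat
  rw [h1]
  simp only [Finset.card_filter, Fin.sum_univ_castSucc, insLast_last, insLast_castSucc,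
    Fin.succAbove_last, Fin.castSucc_inj, if_true]
  rfl

theorem cyc_swpLast {n : ℕ} (i : Fin (n + 1)) (π : Equiv.Perm (Fin n)) :
    cycStat (swpLast i π) = cycStat π + (if i = Fin.last n then 1 else 0) := by
  by_cases hi : i = Fin.last n
  · subst hi
    simp only [swpLast, Equiv.swap_self, if_true]
    exact cyc_ext π
  · have h1 := cyc_swap_aux (insLast (Fin.last n) π) i (Fin.last n) (insLast_last _ _) hi
    have h2 := cyc_ext π
    simp only [hi, if_false]
    unfold cycStat swpLast at *
    omega

/-- The list `l` is a sorting factorization of `σ`. -/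
def SortFac {n : ℕ} (σ : Equiv.Perm (Fin n)) (l : List (Fin n × Fin n)) : Prop :=
  (∀ p ∈ l, p.1 < p.2) ∧ l.Pairwise (fun p q => p.2 < q.2) ∧
      σ = (l.map fun p => Equiv.swap p.1 p.2).prod

/-- The total size of a factorization. -/
def facSum {n : ℕ} (l : List (Fin n × Fin n)) : ℕ :=
  (l.map fun p => (p.2 : ℕ) - (p.1 : ℕ)).sum

/-- Lift a list of pairs along `castSucc`. -/
def liftL {n : ℕ} (l : List (Fin n × Fin n)) : List (Fin (n + 1) × Fin (n + 1)) :=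
  l.map fun p => (p.1.castSucc, p.2.castSucc)

theorem insLast_mul {n : ℕ} (π ρ : Equiv.Perm (Fin n)) :
    insLast (Fin.last n) (π * ρ) = insLast (Fin.last n) π * insLast (Fin.last n) ρ := by
  ext x : 1
  refine Fin.lastCases ?_ (fun j => ?_) x
  · simp [insLast_last]
  · simp [insLast_castSucc]

theorem insLast_one {n : ℕ} : insLast (Fin.last n) (1 : Equiv.Perm (Fin n)) = 1 := by
  ext x : 1
  refine Fin.lastCases ?_ (fun j => ?_) x
  · simp [insLast_last]
  · simp [insLast_castSucc]

theorem insLast_inv {n : ℕ} (π : Equiv.Perm (Fin n)) :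
    (insLast (Fin.last n) π)⁻¹ = insLast (Fin.last n) π⁻¹ := by
  rw [inv_eq_iff_mul_eq_one, ← insLast_mul, mul_inv_cancel, insLast_one]

theorem insLast_swap {n : ℕ} (a b : Fin n) :
    insLast (Fin.last n) (Equiv.swap a b) = Equiv.swap a.castSucc b.castSucc := by
  ext x : 1
  refine Fin.lastCases ?_ (fun j => ?_) x
  · rw [insLast_last, Equiv.swap_apply_of_ne_of_ne]
    · exact (Fin.castSucc_lt_last _).ne'
    · exact (Fin.castSucc_lt_last _).ne'
  · rw [insLast_castSucc, Fin.succAbove_last]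
    exact (Fin.castSucc_injective n).map_swap a b j

theorem prod_liftL {n : ℕ} (l : List (Fin n × Fin n)) :
    ((liftL l).map fun p => Equiv.swap p.1 p.2).prod =
      insLast (Fin.last n) ((l.map fun p => Equiv.swap p.1 p.2).prod) := by
  induction l with
  | nil => simp [liftL, insLast_one]
  | cons p l ih =>
    simp only [liftL, List.map_cons, List.prod_cons, insLast_mul, insLast_swap] at ih ⊢
    rw [ih]

theorem facSum_liftL {n : ℕ} (l : List (Fin n × Fin n)) : facSum (liftL l) = facSum l := by
  simp [facSum, liftL, Function.comp_def]

theorem exists_liftL {n : ℕ} (l : List (Fin (n + 1) × Fin (n + 1)))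
    (h : ∀ p ∈ l, p.1 < p.2) (h' : ∀ p ∈ l, p.2 < Fin.last n) : ∃ l', l = liftL l' := by
  induction l with
  | nil => exact ⟨[], rfl⟩
  | cons p l ih =>
    obtain ⟨l', rfl⟩ := ih (fun q hq => h q (List.mem_cons_of_mem _ hq))
      (fun q hq => h' q (List.mem_cons_of_mem _ hq))
    have h1 := h p List.mem_cons_self
    have h2 := h' p List.mem_cons_self
    refine ⟨(p.1.castPred (h1.trans h2).ne, p.2.castPred h2.ne) :: l', ?_⟩
    simp [liftL]

theorem sortFac_liftL {n : ℕ} (π : Equiv.Perm (Fin n)) (l : List (Fin n × Fin n)) :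
    SortFac (insLast (Fin.last n) π) (liftL l) ↔ SortFac π l := by
  unfold SortFac
  rw [prod_liftL]
  refine and_congr ?_ (and_congr ?_ ?_)
  · simp only [liftL, List.forall_mem_map, Fin.castSucc_lt_castSucc_iff]
  · simp [liftL, List.pairwise_map]
  · exact ⟨fun h => (insLast_inj h).2, fun h => by rw [h]⟩

theorem swpLast_inv {n : ℕ} (i : Fin (n + 1)) (π : Equiv.Perm (Fin n)) :
    (swpLast i π)⁻¹ = insLast (Fin.last n) π⁻¹ * Equiv.swap i (Fin.last n) := by
  rw [swpLast, mul_inv_rev, insLast_inv, Equiv.swap_inv]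

theorem sortFac_up {n : ℕ} (i : Fin (n + 1)) (π : Equiv.Perm (Fin n))
    (l : List (Fin n × Fin n)) (h : SortFac π⁻¹ l) : ∃ l', SortFac (swpLast i π)⁻¹ l' := by
  rw [swpLast_inv]
  have h' := (sortFac_liftL _ _).2 h
  by_cases hi : i = Fin.last n
  · subst hi
    refine ⟨liftL l, ?_⟩
    rw [Equiv.swap_self]
    exact h'
  · refine ⟨liftL l ++ [(i, Fin.last n)], ?_, ?_, ?_⟩
    · intro p hp
      rw [List.mem_append] at hp
      rcases hp with hp | hp
      · exact h'.1 p hp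
      · rw [List.mem_singleton] at hp
        subst hp
        exact Fin.lt_last_iff_ne_last.2 hi
    · rw [List.pairwise_append]
      refine ⟨h'.2.1, List.pairwise_singleton _ _, ?_⟩
      intro p hp q hq
      rw [List.mem_singleton] at hq
      subst hq
      simp only [liftL, List.mem_map] at hp
      obtain ⟨r, -, rfl⟩ := hp
      exact Fin.castSucc_lt_last _
    · rw [List.map_append, List.prod_append, ← h'.2.2]
      simp

theorem sortFac_down {n : ℕ} (i : Fin (n + 1)) (π : Equiv.Perm (Fin n))
    (l : List (Fin (n + 1) × Fin (n + 1))) (h : SortFac (swpLast i π)⁻¹ l) :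
    ∃ l', SortFac π⁻¹ l' ∧ facSum l = facSum l' + (n - i) := by
  have key : ∀ l : List (Fin (n + 1) × Fin (n + 1)), SortFac (swpLast i π)⁻¹ l →
      (∀ p ∈ l, p.2 < Fin.last n) →
      ∃ l', SortFac π⁻¹ l' ∧ facSum l = facSum l' + (n - i) := by
    intro l h hl
    obtain ⟨l', rfl⟩ := exists_liftL l h.1 hl
    have h3 := h.2.2
    rw [prod_liftL, inv_eq_iff_eq_inv, insLast_inv] at h3
    have h4 : swpLast i π =
        swpLast (Fin.last n) ((l'.map fun p => Equiv.swap p.1 p.2).prod)⁻¹ := by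
      rw [h3, swpLast, Equiv.swap_self]; rfl
    obtain ⟨rfl, h5⟩ := swpLast_inj h4
    refine ⟨l', ?_, by simp [facSum_liftL]⟩
    rw [← sortFac_liftL]
    convert h using 1
    rw [swpLast_inv, Equiv.swap_self]; rfl
  rcases List.eq_nil_or_concat l with rfl | ⟨l0, p, rfl⟩
  · exact key _ h (by simp)
  · rw [List.concat_eq_append] at *
    obtain ⟨ha, hb, hc⟩ := h
    have hb' := List.pairwise_append.1 hb
    have hlt : ∀ q ∈ l0, q.2 < p.2 := fun q hq => hb'.2.2 q hq p (by simp)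
    by_cases hp : p.2 = Fin.last n
    · rw [hp] at hlt
      obtain ⟨l', rfl⟩ := exists_liftL l0 (fun q hq => ha q (by simp [hq])) hlt
      rw [List.map_append, List.prod_append, prod_liftL, inv_eq_iff_eq_inv] at hc
      have h4 : swpLast i π =
          swpLast p.1 ((l'.map fun p => Equiv.swap p.1 p.2).prod)⁻¹ := by
        rw [hc, swpLast, mul_inv_rev, insLast_inv]
        simp [hp]
      obtain ⟨rfl, h5⟩ := swpLast_inj h4
      refine ⟨l', ?_, ?_⟩
      · rw [← sortFac_liftL]
        refine ⟨fun q hq => ha q (by simp [hq]), hb'.1, ?_⟩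
        rw [prod_liftL, h5, inv_inv]
      · rw [← facSum_liftL l']
        simp [facSum, hp]
    · refine key _ ⟨ha, hb, hc⟩ ?_
      have hp' : p.2 < Fin.last n := Fin.lt_last_iff_ne_last.2 hp
      intro q hq
      rw [List.mem_append] at hq
      rcases hq with hq | hq
      · exact (hlt q hq).trans hp'
      · rw [List.mem_singleton] at hq
        subst hq; exact hp'

theorem sortFac_unique (n : ℕ) : ∀ σ : Equiv.Perm (Fin n),
    (∃ l, SortFac σ⁻¹ l) ∧ ∀ l l', SortFac σ⁻¹ l → SortFac σ⁻¹ l' → facSum l = facSum l' := by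
  induction n with
  | zero =>
    intro σ
    refine ⟨⟨[], by simp, by simp, Subsingleton.elim _ _⟩, ?_⟩
    intro l l' _ _
    have : ∀ l : List (Fin 0 × Fin 0), l = [] := by
      intro l
      cases l with
      | nil => rfl
      | cons p _ => exact p.1.elim0
    rw [this l, this l']
  | succ n ih =>
    intro σ
    obtain ⟨⟨i, π⟩, rfl⟩ := (swpLast_bij n).2 σ
    obtain ⟨⟨l, hl⟩, hu⟩ := ih π
    refine ⟨sortFac_up i π l hl, ?_⟩
    intro l1 l2 h1 h2
    obtain ⟨m1, hm1, e1⟩ := sortFac_down i π l1 h1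
    obtain ⟨m2, hm2, e2⟩ := sortFac_down i π l2 h2
    rw [e1, e2, hu _ _ hm1 hm2]

theorem chain_iff {n : ℕ} (l : List (Fin n × Fin n)) :
    l.IsChain (fun p q => p.2 < q.2) ↔ l.Pairwise (fun p q => p.2 < q.2) := by
  have : IsTrans (Fin n × Fin n) (fun p q => p.2 < q.2) := ⟨fun _ _ _ h h' => lt_trans h h'⟩
  exact List.isChain_iff_pairwise

theorem DIS_eq {n : ℕ} (σ : Equiv.Perm (Fin n)) (l : List (Fin n × Fin n))
    (h : SortFac σ⁻¹ l) : DIS σ = facSum l := by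
  have hex : ∃ l : List (Fin n × Fin n),
      (∀ p ∈ l, p.1 < p.2) ∧ l.Chain' (fun p q => p.2 < q.2) ∧
      σ⁻¹ = (l.map fun p => Equiv.swap p.1 p.2).prod :=
    ⟨l, h.1, (chain_iff l).2 h.2.1, h.2.2⟩
  unfold DIS sorStat
  rw [dif_pos hex]
  have hs := hex.choose_spec
  exact (sortFac_unique n σ).2 _ _ ⟨hs.1, (chain_iff _).1 hs.2.1, hs.2.2⟩ h

theorem DIS_swpLast {n : ℕ} (i : Fin (n + 1)) (π : Equiv.Perm (Fin n)) :
    DIS (swpLast i π) = DIS π + (n - i) := by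
  obtain ⟨l, hl⟩ := (sortFac_unique (n + 1) (swpLast i π)).1
  obtain ⟨l', hl', e⟩ := sortFac_down i π l hl
  rw [DIS_eq _ _ hl, DIS_eq _ _ hl', e]

theorem exists_equiv (n : ℕ) : ∃ φ : Equiv.Perm (Fin n) ≃ Equiv.Perm (Fin n),
    ∀ σ, DIS (φ σ) = invStat σ ∧ cycStat (φ σ) = lmaxStat σ ∧
      ∀ k, maxdrop (φ σ) ≤ k ↔ maxdrop σ ≤ k := by
  induction n with
  | zero =>
    refine ⟨Equiv.refl _, fun σ => ⟨?_, ?_, fun k => Iff.rfl⟩⟩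
    · rw [DIS_eq (Equiv.refl _ σ) [] ⟨by simp, by simp, Subsingleton.elim _ _⟩]
      simp [facSum, invStat]
    · have : Equiv.refl _ σ = 1 := Subsingleton.elim _ _
      rw [this]
      simp [cycStat, lmaxStat]
  | succ n ih =>
    obtain ⟨φ, hφ⟩ := ih
    let e1 := Equiv.ofBijective _ (insLast_bij n)
    let e2 := Equiv.ofBijective _ (swpLast_bij n)
    refine ⟨(e1.symm.trans ((Equiv.refl _).prodCongr φ)).trans e2, fun σ => ?_⟩
    obtain ⟨⟨i, π⟩, rfl⟩ := e1.surjective σ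
    have h1 : ((e1.symm.trans ((Equiv.refl _).prodCongr φ)).trans e2) (e1 (i, π)) =
        swpLast i (φ π) := by
      simp [e2]
    have h2 : e1 (i, π) = insLast i π := rfl
    rw [h1, h2]
    obtain ⟨ha, hb, hc⟩ := hφ π
    refine ⟨?_, ?_, fun k => ?_⟩
    · rw [DIS_swpLast, inv_insLast, ha]
    · rw [cyc_swpLast, lmax_insLast, hb]
    · rw [maxdrop_swpLast, maxdrop_insLast, hc]

/-- For `0 ≤ k < n`, the pairs of statistics `(inv, lmax)` and
`(DIS, cyc)` have the same joint distribution over `A(n,k)`. -/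
theorem stmt0 (n k : ℕ) (hk : k < n) (a b : ℕ) :
    ((bddA n k).filter fun σ => invStat σ = a ∧ lmaxStat σ = b).card =
    ((bddA n k).filter fun σ => DIS σ = a ∧ cycStat σ = b).card := by
  obtain ⟨φ, hφ⟩ := exists_equiv n
  refine Finset.card_bij (fun σ _ => φ σ) ?_ ?_ ?_
  · intro σ hσ
    obtain ⟨ha, hb, hc⟩ := hφ σ
    simp only [bddA, Finset.mem_filter, Finset.mem_univ, true_and] at hσ ⊢
    exact ⟨(hc k).2 hσ.1, ha.trans hσ.2.1, hb.trans hσ.2.2⟩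
  · intro σ _ τ _ h
    exact φ.injective h
  · intro τ hτ
    obtain ⟨σ, rfl⟩ := φ.surjective τ
    obtain ⟨ha, hb, hc⟩ := hφ σ
    refine ⟨σ, ?_, rfl⟩
    simp only [bddA, Finset.mem_filter, Finset.mem_univ, true_and] at hτ ⊢
    exact ⟨(hc k).1 hτ.1, ha.symm.trans hτ.2.1, hb.symm.trans hτ.2.2⟩
end

section
/- For all integers n ≥ 1 and 0 < k ≤ n, the following polynomial identity in ℤ[q,t] holds: Σ_{σ ∈ S(n,k)} q^{sor(σ)} t^{cyc(σ)} = (t + [k+1]_q − 1)^{n−k} · Π_{i=1}^{k} (t + [i]_q − 1). -/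
attribute [local instance] Classical.propDecidable

/-- Valid sorting factorizations. -/
def SorValid {n : ℕ} (l : List (Fin n × Fin n)) : Prop :=
  (∀ p ∈ l, p.1 < p.2) ∧ l.Pairwise (fun p q => p.2 < q.2)

/-- Product of the transpositions. -/
def sorProd {n : ℕ} (l : List (Fin n × Fin n)) : Equiv.Perm (Fin n) :=
  (l.map fun p => Equiv.swap p.1 p.2).prod

/-- Sum of the differences. -/
def sorSum {n : ℕ} (l : List (Fin n × Fin n)) : ℕ :=
  (l.map fun p => (p.2 : ℕ) - (p.1 : ℕ)).sum

lemma sorProd_append {n : ℕ} (l : List (Fin n × Fin n)) (p : Fin n × Fin n) :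
    sorProd (l ++ [p]) = sorProd l * Equiv.swap p.1 p.2 := by
  simp [sorProd]

lemma sorSum_append {n : ℕ} (l : List (Fin n × Fin n)) (p : Fin n × Fin n) :
    sorSum (l ++ [p]) = sorSum l + ((p.2 : ℕ) - (p.1 : ℕ)) := by
  simp [sorSum]

lemma sorValid_append {n : ℕ} (l : List (Fin n × Fin n)) (p : Fin n × Fin n) :
    SorValid (l ++ [p]) ↔ SorValid l ∧ p.1 < p.2 ∧ ∀ r ∈ l, r.2 < p.2 := by
  unfold SorValid
  simp only [List.mem_append, List.mem_singleton, List.pairwise_append]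
  constructor
  · rintro ⟨h1, h2, -, h3⟩
    exact ⟨⟨fun p hp => h1 p (Or.inl hp), h2⟩, h1 p (Or.inr rfl), fun r hr => h3 r hr p rfl⟩
  · rintro ⟨⟨h1, h2⟩, h3, h4⟩
    refine ⟨?_, h2, List.pairwise_singleton _ _, ?_⟩
    · rintro r (hr | rfl)
      · exact h1 r hr
      · exact h3
    · rintro r hr b rfl
      exact h4 r hr

lemma sorProd_fix {n : ℕ} (l : List (Fin n × Fin n)) (hl : SorValid l) (x : Fin n)
    (hx : ∀ p ∈ l, p.2 < x) : sorProd l x = x := by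
  induction l using List.reverseRecOn with
  | nil => simp [sorProd]
  | append_singleton l p ih =>
    rw [sorValid_append] at hl
    have hp := hx p (by simp)
    rw [sorProd_append, Equiv.Perm.mul_apply,
      Equiv.swap_apply_of_ne_of_ne (hl.2.1.trans hp).ne' hp.ne']
    exact ih hl.1 fun r hr => hx r (by simp [hr])

lemma sorProd_top {n : ℕ} (l : List (Fin n × Fin n)) (p : Fin n × Fin n)
    (hl : SorValid (l ++ [p])) : sorProd (l ++ [p]) p.1 = p.2 := by
  rw [sorValid_append] at hl
  rw [sorProd_append, Equiv.Perm.mul_apply, Equiv.swap_apply_left]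
  exact sorProd_fix l hl.1 _ hl.2.2

lemma sorProd_le {n : ℕ} (l : List (Fin n × Fin n)) (p : Fin n × Fin n)
    (hl : SorValid (l ++ [p])) (x : Fin n) (hx : p.2 < x) : sorProd (l ++ [p]) x = x := by
  apply sorProd_fix _ hl
  rw [sorValid_append] at hl
  intro r hr
  rw [List.mem_append, List.mem_singleton] at hr
  rcases hr with hr | rfl
  · exact (hl.2.2 r hr).trans hx
  · exact hx

lemma sor_top_le {n : ℕ} (l l' : List (Fin n × Fin n)) (p p' : Fin n × Fin n)
    (hl : SorValid (l ++ [p])) (hl' : SorValid (l' ++ [p']))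
    (h : sorProd (l ++ [p]) = sorProd (l' ++ [p'])) : p.2 ≤ p'.2 := by
  by_contra hc
  push Not at hc
  have h1 := sorProd_le l' p' hl' p.2 hc
  rw [← h] at h1
  have h2 := sorProd_top l p hl
  have h3 := (sorProd (l ++ [p])).injective (h1.trans h2.symm)
  rw [sorValid_append] at hl
  exact absurd h3 hl.2.1.ne'

lemma sor_unique {n : ℕ} (l : List (Fin n × Fin n)) : ∀ (l' : List (Fin n × Fin n)),
    SorValid l → SorValid l' → sorProd l = sorProd l' → l = l' := by
  have key : ∀ (l : List (Fin n × Fin n)) (p : Fin n × Fin n), SorValid (l ++ [p]) →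
      sorProd (l ++ [p]) ≠ 1 := by
    intro l p hl h
    have h2 := sorProd_top l p hl
    rw [h] at h2
    rw [sorValid_append] at hl
    exact absurd h2 hl.2.1.ne
  induction l using List.reverseRecOn with
  | nil =>
    intro l' _ hl' h
    rcases List.eq_nil_or_concat l' with rfl | ⟨b, p, rfl⟩
    · rfl
    · rw [List.concat_eq_append] at hl' h
      exact absurd (h.symm.trans (by simp [sorProd])) (key b p hl')
  | append_singleton l p ih =>
    intro l' hl hl' h
    rcases List.eq_nil_or_concat l' with rfl | ⟨b, p', rfl⟩
    · exact absurd (h.trans (by simp [sorProd])) (key l p hl)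
    · rw [List.concat_eq_append] at hl' h ⊢
      have e2 : p.2 = p'.2 := le_antisymm (sor_top_le _ _ _ _ hl hl' h)
        (sor_top_le _ _ _ _ hl' hl h.symm)
      have t1 := sorProd_top l p hl
      have t2 := sorProd_top b p' hl'
      rw [← h, ← e2, ← t1] at t2
      have e1 := (sorProd (l ++ [p])).injective t2
      have e : p = p' := Prod.ext e1.symm e2
      subst e
      rw [sorProd_append, sorProd_append] at h
      rw [sorValid_append] at hl hl'
      rw [ih b hl.1 hl'.1 (mul_right_cancel h)]

lemma sorStat_eq {n : ℕ} (l : List (Fin n × Fin n)) (hl : SorValid l) :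
    sorStat (sorProd l) = sorSum l := by
  have conv : ∀ l : List (Fin n × Fin n),
      l.IsChain (fun p q => p.2 < q.2) ↔ l.Pairwise (fun p q => p.2 < q.2) := by
    intro l
    haveI : Trans (fun p q : Fin n × Fin n => p.2 < q.2)
      (fun p q : Fin n × Fin n => p.2 < q.2) (fun p q : Fin n × Fin n => p.2 < q.2) :=
      ⟨fun h1 h2 => lt_trans h1 h2⟩
    exact List.isChain_iff_pairwise
  have h : ∃ l' : List (Fin n × Fin n),
      (∀ p ∈ l', p.1 < p.2) ∧ l'.Chain' (fun p q => p.2 < q.2) ∧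
      sorProd l = (l'.map fun p => Equiv.swap p.1 p.2).prod :=
    ⟨l, hl.1, (conv l).2 hl.2, rfl⟩
  have e : sorStat (sorProd l) = sorSum h.choose := by
    unfold sorStat
    rw [dif_pos h]
    rfl
  rw [e]
  have hs := h.choose_spec
  rw [← sor_unique l h.choose hl ⟨hs.1, (conv _).1 hs.2.1⟩ hs.2.2]

lemma sor_exists {n : ℕ} (m : ℕ) (hm : m ≤ n) : ∀ (σ : Equiv.Perm (Fin n)),
    (∀ x : Fin n, m ≤ (x : ℕ) → σ x = x) →
    ∃ l : List (Fin n × Fin n), SorValid l ∧ (∀ p ∈ l, (p.2 : ℕ) < m) ∧ sorProd l = σ := by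
  induction m with
  | zero =>
    intro σ h
    refine ⟨[], by simp [SorValid], by simp, ?_⟩
    ext x
    simp [sorProd, h x]
  | succ m ih =>
    intro σ h
    let a : Fin n := ⟨m, hm⟩
    by_cases ha : σ a = a
    · obtain ⟨l, h1, h2, h3⟩ := ih (by omega) σ (fun x hx => by
        rcases eq_or_lt_of_le hx with e | e
        · have : x = a := Fin.ext e.symm
          rw [this, ha]
        · exact h x e)
      exact ⟨l, h1, fun p hp => (h2 p hp).trans (Nat.lt_succ_self m), h3⟩
    · have hi : σ (σ⁻¹ a) = a := by simp
      have hia : σ⁻¹ a ≠ a := fun e => ha (by rw [e] at hi; exact hi)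
      have hlt : σ⁻¹ a < a := by
        by_contra hc
        have h1 : a < σ⁻¹ a := lt_of_le_of_ne (not_lt.1 hc) hia.symm
        have := h (σ⁻¹ a) h1
        exact hia (this.symm.trans hi)
      obtain ⟨l, h1, h2, h3⟩ := ih (by omega) (σ * Equiv.swap (σ⁻¹ a) a) (fun x hx => by
        rcases eq_or_lt_of_le hx with e | e
        · have : x = a := Fin.ext e.symm
          rw [this]
          simp
        · have e' : a < x := e
          rw [Equiv.Perm.mul_apply, Equiv.swap_apply_of_ne_of_ne (hlt.trans e').ne' e'.ne']
          exact h x e)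
      refine ⟨l ++ [(σ⁻¹ a, a)], (sorValid_append _ _).2 ⟨h1, hlt, fun r hr => h2 r hr⟩, ?_, ?_⟩
      · intro p hp
        rw [List.mem_append, List.mem_singleton] at hp
        rcases hp with hp | rfl
        · exact (h2 p hp).trans (Nat.lt_succ_self m)
        · exact Nat.lt_succ_self m
      · rw [sorProd_append, h3, mul_assoc, Equiv.swap_mul_self, mul_one]

lemma sorStat_mul {n : ℕ} (σ : Equiv.Perm (Fin n)) (i a : Fin n) (hia : i < a)
    (h : ∀ x : Fin n, a ≤ x → σ x = x) :
    sorStat (σ * Equiv.swap i a) = sorStat σ + ((a : ℕ) - (i : ℕ)) := by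
  obtain ⟨l, h1, h2, rfl⟩ := sor_exists (a : ℕ) a.2.le σ h
  have hv : SorValid (l ++ [(i, a)]) := (sorValid_append _ _).2 ⟨h1, hia, fun r hr => h2 r hr⟩
  have e := sorProd_append l (i, a)
  simp only at e
  rw [← e, sorStat_eq _ hv, sorStat_eq _ h1, sorSum_append]

lemma sorStat_one {n : ℕ} : sorStat (1 : Equiv.Perm (Fin n)) = 0 := by
  have h := sorStat_eq ([] : List (Fin n × Fin n)) (by simp [SorValid])
  simpa [sorProd, sorSum] using h

lemma cycStat_support {n : ℕ} (σ : Equiv.Perm (Fin n)) :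
    cycStat σ + σ.support.card = σ.cycleType.card + n := by
  have h : (Finset.univ.filter fun i => σ i = i).card + σ.support.card = n := by
    have := Finset.card_filter_add_card_filter_not (s := (Finset.univ : Finset (Fin n)))
      (fun i => σ i = i)
    rw [Finset.card_univ, Fintype.card_fin] at this
    have e : σ.support = Finset.univ.filter fun i => ¬ σ i = i := by
      ext x
      simp
    rw [e]
    exact this
  unfold cycStat
  omega

lemma cycStat_one {n : ℕ} : cycStat (1 : Equiv.Perm (Fin n)) = n := by
  have := cycStat_support (1 : Equiv.Perm (Fin n))
  simpa using this

lemma cycle_extend {n : ℕ} (c : Equiv.Perm (Fin n)) (hc : c.IsCycle) (i a : Fin n)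
    (hi : c i ≠ i) (ha : c a = a) :
    (c * Equiv.swap i a).IsCycle := by
  have e : c * Equiv.swap i a = Equiv.swap a (c i) * c := by
    rw [Equiv.mul_swap_eq_swap_mul, ha, Equiv.swap_comm]
  have hy : c (c i) ≠ c i := fun h => hi (c.injective h)
  have hmem : c i ∈ c.support := by simpa using hy
  have hlen := (Equiv.Perm.two_le_length_toList_iff_mem_support (p := c) (x := c i)).2 hmem
  have hform : (Equiv.Perm.toList c (c i)).formPerm = c := by
    rw [Equiv.Perm.formPerm_toList, hc.cycleOf_eq hy]
  have hnd := Equiv.Perm.nodup_toList c (c i)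
  have hanot : a ∉ Equiv.Perm.toList c (c i) := by
    rw [Equiv.Perm.mem_toList_iff]
    rintro ⟨h1, -⟩
    have := (h1.apply_eq_self_iff).2 ha
    exact hy this
  have hget : (Equiv.Perm.toList c (c i))[0]'(by omega) = c i := by
    rw [Equiv.Perm.getElem_toList, pow_zero, Equiv.Perm.one_apply]
  rw [e]
  rcases hL : Equiv.Perm.toList c (c i) with _ | ⟨y, L⟩
  · rw [hL] at hlen; simp at hlen
  · rw [hL] at hform hnd hanot
    have hyy : y = c i := by
      rw [← hget]
      simp [hL]
    subst hyy
    have : Equiv.swap a (c i) * c = (a :: c i :: L).formPerm := by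
      rw [List.formPerm_cons_cons, hform]
    rw [this]
    apply List.isCycle_formPerm
    · exact List.nodup_cons.2 ⟨hanot, hnd⟩
    · simp

lemma cycStat_mul {n : ℕ} (σ : Equiv.Perm (Fin n)) (i a : Fin n) (hia : i ≠ a)
    (ha : σ a = a) : cycStat (σ * Equiv.swap i a) + 1 = cycStat σ := by
  have s1 := cycStat_support σ
  have s2 := cycStat_support (σ * Equiv.swap i a)
  by_cases hi : σ i = i
  · have hd : σ.Disjoint (Equiv.swap i a) := by
      intro x
      by_cases h1 : x = i
      · left; rw [h1, hi]
      · by_cases h2 : x = a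
        · left; rw [h2, ha]
        · right; exact Equiv.swap_apply_of_ne_of_ne h1 h2
    have e1 := hd.cycleType_mul
    have e2 := hd.card_support_mul
    rw [(Equiv.Perm.isCycle_swap hia).cycleType] at e1
    rw [Equiv.Perm.card_support_swap hia] at e2
    rw [e1, e2] at s2
    simp at s2
    omega
  · set c := σ.cycleOf i with hcdef
    have hc : c.IsCycle := Equiv.Perm.isCycle_cycleOf σ hi
    have hci : c i = σ i := Equiv.Perm.cycleOf_apply_self σ i
    have hca : c a = a := by
      by_cases h : σ.SameCycle i a
      · exact absurd (h.apply_eq_self_iff.2 ha) hi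
      · exact Equiv.Perm.cycleOf_apply_of_not_sameCycle h
    have hdis : (σ * c⁻¹).Disjoint c :=
      Equiv.Perm.disjoint_mul_inv_of_mem_cycleFactorsFinset
        (Equiv.Perm.cycleOf_mem_cycleFactorsFinset_iff.2 (by simpa using hi))
    set d := σ * c⁻¹ with hd
    have hs : σ = d * c := by simp [hd]
    have hic : c i ≠ i := by rw [hci]; exact hi
    have hdi : d i = i := (hdis i).resolve_right hic
    have hda : d a = a := by
      have : c⁻¹ a = a := by rw [Equiv.Perm.inv_eq_iff_eq, hca]
      rw [hd, Equiv.Perm.mul_apply, this, ha]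
    have hcyc := cycle_extend c hc i a hic hca
    have hsupp : (c * Equiv.swap i a).support = insert a c.support := by
      ext x
      simp only [Equiv.Perm.mem_support, Finset.mem_insert, Equiv.Perm.mul_apply]
      by_cases h1 : x = i
      · subst h1
        simp [hca, hic, hia.symm]
      · by_cases h2 : x = a
        · subst h2
          simp only [Equiv.swap_apply_right, true_or, iff_true]
          intro h
          exact hia (by
            have := c.injective (h.trans hca.symm)
            exact this)
        · rw [Equiv.swap_apply_of_ne_of_ne h1 h2]
          simp [h2]
    have hdis2 : d.Disjoint (c * Equiv.swap i a) := by
      intro x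
      by_cases h2 : x = a
      · left; rw [h2, hda]
      · rcases hdis x with h | h
        · left; exact h
        · right
          have : x ∉ (c * Equiv.swap i a).support := by
            rw [hsupp]
            simp [h2, h]
          simpa using this
    have hca' : a ∉ c.support := by simpa using hca
    have e1 := hdis2.cycleType_mul
    have e2 := hdis2.card_support_mul
    have f1 := hdis.cycleType_mul
    have f2 := hdis.card_support_mul
    rw [hcyc.cycleType] at e1
    rw [hc.cycleType] at f1
    rw [hsupp, Finset.card_insert_of_notMem hca'] at e2
    rw [← hs] at f1 f2
    rw [← mul_assoc, ← hs] at e1 e2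
    have e1' := congrArg Multiset.card e1
    have f1' := congrArg Multiset.card f1
    simp only [Multiset.card_add, Multiset.card_singleton] at e1' f1'
    omega

/-- Permutations in `S(n,k)` fixing all `x ≥ m`. -/
def bddP (n k m : ℕ) : Finset (Equiv.Perm (Fin n)) :=
  Finset.univ.filter fun σ => (∀ i : Fin n, (σ i : ℕ) ≤ (i : ℕ) + k) ∧
    ∀ x : Fin n, m ≤ (x : ℕ) → σ x = x

open MvPolynomial in
lemma weight_sum (n k m : ℕ) (hm : m < n) :
    ∑ i ∈ Finset.univ.filter (fun i : Fin n => (i : ℕ) ≤ m ∧ m ≤ (i : ℕ) + k),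
      (if (i : ℕ) = m then (X 1 : MvPolynomial (Fin 2) ℤ) else X 0 ^ (m - (i : ℕ))) =
    X 1 + qBracket (min m k + 1) - 1 := by
  have hq : qBracket (min m k + 1) =
      ∑ j ∈ Finset.range (min m k), (X 0 : MvPolynomial (Fin 2) ℤ) ^ (j + 1) + 1 := by
    unfold qBracket
    rw [Finset.sum_range_succ']
    simp
  have hmem : (⟨m, hm⟩ : Fin n) ∈
      Finset.univ.filter (fun i : Fin n => (i : ℕ) ≤ m ∧ m ≤ (i : ℕ) + k) := by simp
  rw [← Finset.add_sum_erase _ _ hmem, hq]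
  have : ∑ i ∈ (Finset.univ.filter
        (fun i : Fin n => (i : ℕ) ≤ m ∧ m ≤ (i : ℕ) + k)).erase ⟨m, hm⟩,
      (if (i : ℕ) = m then (X 1 : MvPolynomial (Fin 2) ℤ) else X 0 ^ (m - (i : ℕ))) =
      ∑ j ∈ Finset.range (min m k), (X 0 : MvPolynomial (Fin 2) ℤ) ^ (j + 1) := by
    refine Finset.sum_bij' (fun i _ => m - (i : ℕ) - 1)
      (fun j _ => ⟨m - (j + 1), by omega⟩) ?_ ?_ ?_ ?_ ?_
    · intro i hi
      simp only [Finset.mem_erase, Finset.mem_filter, Finset.mem_univ, true_and, ne_eq,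
        Fin.ext_iff] at hi
      rw [Finset.mem_range]
      omega
    · intro j hj
      rw [Finset.mem_range] at hj
      simp only [Finset.mem_erase, Finset.mem_filter, Finset.mem_univ, true_and, ne_eq,
        Fin.ext_iff]
      omega
    · intro i hi
      simp only [Finset.mem_erase, Finset.mem_filter, Finset.mem_univ, true_and, ne_eq,
        Fin.ext_iff] at hi
      ext
      simp only
      omega
    · intro j hj
      rw [Finset.mem_range] at hj
      simp only
      omega
    · intro i hi
      simp only [Finset.mem_erase, Finset.mem_filter, Finset.mem_univ, true_and, ne_eq,
        Fin.ext_iff] at hi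
      rw [if_neg hi.1]
      congr 1
      omega
  rw [this]
  simp
  ring

lemma bddP_mul (n k m : ℕ) (hm : m < n) (σ : Equiv.Perm (Fin n)) (i : Fin n)
    (hσ : σ ∈ bddP n k m) (h1 : (i : ℕ) ≤ m) (h2 : m ≤ (i : ℕ) + k) :
    σ * Equiv.swap i ⟨m, hm⟩ ∈ bddP n k (m + 1) := by
  simp only [bddP, Finset.mem_filter, Finset.mem_univ, true_and] at hσ ⊢
  obtain ⟨ha, hb⟩ := hσ
  have hbm := hb ⟨m, hm⟩ le_rfl
  constructor
  · intro x
    rw [Equiv.Perm.mul_apply]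
    by_cases e1 : x = i
    · subst e1
      rw [Equiv.swap_apply_left, hbm]
      exact h2
    · by_cases e2 : x = ⟨m, hm⟩
      · rw [e2, Equiv.swap_apply_right]
        have : (σ i : ℕ) ≤ m := by
          by_contra hc
          push Not at hc
          have h3 := hb (σ i) hc.le
          have h4 := σ.injective h3
          rw [h4] at hc
          omega
        exact this.trans (Nat.le_add_right _ _)
      · rw [Equiv.swap_apply_of_ne_of_ne e1 e2]
        exact ha x
  · intro x hx
    rw [Equiv.Perm.mul_apply, Equiv.swap_apply_of_ne_of_ne]
    · exact hb x (by omega)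
    · rintro rfl; omega
    · rintro rfl; simp at hx

lemma bddP_inv (n k m : ℕ) (hm : m < n) (σ : Equiv.Perm (Fin n))
    (hσ : σ ∈ bddP n k (m + 1)) :
    σ * Equiv.swap (σ⁻¹ ⟨m, hm⟩) ⟨m, hm⟩ ∈ bddP n k m ∧
      ((σ⁻¹ ⟨m, hm⟩ : Fin n) : ℕ) ≤ m ∧ m ≤ ((σ⁻¹ ⟨m, hm⟩ : Fin n) : ℕ) + k := by
  simp only [bddP, Finset.mem_filter, Finset.mem_univ, true_and] at hσ ⊢
  obtain ⟨ha, hb⟩ := hσ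
  set a : Fin n := ⟨m, hm⟩ with hadef
  have hi : σ (σ⁻¹ a) = a := by simp
  set i := σ⁻¹ a with hidef
  have hle : (i : ℕ) ≤ m := by
    by_contra hc
    push Not at hc
    have := hb i hc
    rw [hi] at this
    rw [← this, hadef] at hc
    simp at hc
  have hk : m ≤ (i : ℕ) + k := by
    have := ha i
    rw [hi] at this
    exact this
  refine ⟨⟨?_, ?_⟩, hle, hk⟩
  · intro x
    rw [Equiv.Perm.mul_apply]
    by_cases e2 : x = a
    · rw [e2, Equiv.swap_apply_right, hi]
      omega
    · by_cases e1 : x = i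
      · rw [e1, Equiv.swap_apply_left]
        have : (σ a : ℕ) ≤ m := by
          by_contra hc
          push Not at hc
          have h4 := σ.injective (hb (σ a) hc)
          rw [h4, hadef] at hc
          simp at hc
        omega
      · rw [Equiv.swap_apply_of_ne_of_ne e1 e2]
        exact ha x
  · intro x hx
    rw [Equiv.Perm.mul_apply]
    by_cases e2 : x = a
    · rw [e2, Equiv.swap_apply_right, hi]
    · have hlt : m < (x : ℕ) := lt_of_le_of_ne hx fun e => e2 (Fin.ext e.symm)
      rw [Equiv.swap_apply_of_ne_of_ne _ e2]
      · exact hb x hlt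
      · rintro rfl; omega

open MvPolynomial in
lemma bddP_step (n k m : ℕ) (hm : m < n) :
    X 1 * ∑ σ ∈ bddP n k (m + 1),
        (X 0 : MvPolynomial (Fin 2) ℤ) ^ sorStat σ * X 1 ^ cycStat σ =
    (∑ σ ∈ bddP n k m, (X 0 : MvPolynomial (Fin 2) ℤ) ^ sorStat σ * X 1 ^ cycStat σ) *
      (X 1 + qBracket (min m k + 1) - 1) := by
  rw [← weight_sum n k m hm, Finset.sum_mul_sum, ← Finset.sum_product', Finset.mul_sum]
  symm
  refine Finset.sum_bij' (fun p _ => p.1 * Equiv.swap p.2 ⟨m, hm⟩)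
    (fun σ _ => (σ * Equiv.swap (σ⁻¹ ⟨m, hm⟩) ⟨m, hm⟩, σ⁻¹ ⟨m, hm⟩)) ?_ ?_ ?_ ?_ ?_
  · rintro ⟨σ, i⟩ hp
    simp only [Finset.mem_product, Finset.mem_filter, Finset.mem_univ, true_and] at hp
    exact bddP_mul n k m hm σ i hp.1 hp.2.1 hp.2.2
  · intro σ hσ
    simp only [Finset.mem_product, Finset.mem_filter, Finset.mem_univ, true_and]
    exact bddP_inv n k m hm σ hσ
  · rintro ⟨σ, i⟩ hp
    simp only [Finset.mem_product, Finset.mem_filter, Finset.mem_univ, true_and, bddP] at hp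
    have hbm := hp.1.2 ⟨m, hm⟩ le_rfl
    have e : (σ * Equiv.swap i ⟨m, hm⟩)⁻¹ ⟨m, hm⟩ = i := by
      rw [Equiv.Perm.inv_eq_iff_eq, Equiv.Perm.mul_apply, Equiv.swap_apply_left, hbm]
    simp only [e]
    rw [mul_assoc, Equiv.swap_mul_self, mul_one]
  · intro σ hσ
    simp only
    rw [mul_assoc, Equiv.swap_mul_self, mul_one]
  · rintro ⟨σ, i⟩ hp
    simp only [Finset.mem_product, Finset.mem_filter, Finset.mem_univ, true_and, bddP] at hp
    simp only
    obtain ⟨⟨ha, hb⟩, h1, h2⟩ := hp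
    by_cases e : (i : ℕ) = m
    · have : i = ⟨m, hm⟩ := Fin.ext e
      rw [if_pos e, this, Equiv.swap_self]
      have : (Equiv.refl (Fin n) : Equiv.Perm (Fin n)) = 1 := rfl
      rw [this, mul_one]
      ring
    · have hlt : i < ⟨m, hm⟩ := lt_of_le_of_ne h1 (fun h => e (by rw [h]))
      rw [if_neg e, sorStat_mul σ i ⟨m, hm⟩ hlt (fun x hx => hb x hx),
        ← cycStat_mul σ i ⟨m, hm⟩ hlt.ne (hb _ le_rfl)]
      simp only
      ring

open MvPolynomial in
lemma bddP_sum (n k m : ℕ) (hm : m ≤ n) :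
    X 1 ^ m * ∑ σ ∈ bddP n k m,
        (X 0 : MvPolynomial (Fin 2) ℤ) ^ sorStat σ * X 1 ^ cycStat σ =
    X 1 ^ n * ∏ r ∈ Finset.range m, (X 1 + qBracket (min r k + 1) - 1) := by
  induction m with
  | zero =>
    have : bddP n k 0 = {1} := by
      ext σ
      simp only [bddP, Finset.mem_filter, Finset.mem_univ, true_and, Finset.mem_singleton]
      constructor
      · rintro ⟨-, h⟩
        ext x
        rw [h x (Nat.zero_le _)]
        rfl
      · rintro rfl
        simp
    rw [this]
    simp [sorStat_one, cycStat_one]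
  | succ m ih =>
    rw [pow_succ, mul_assoc, bddP_step n k m hm, ← mul_assoc, ih (by omega),
      Finset.prod_range_succ, mul_assoc]

/-- the joint generating function of `(sor, cyc)` over `S(n,k)`,
in `ℤ[q,t]` with `q = X 0`, `t = X 1`. -/
theorem stmt3 (n k : ℕ) (hn : 1 ≤ n) (hk0 : 0 < k) (hk : k ≤ n) :
    ∑ σ ∈ bddS n k,
        (MvPolynomial.X 0 : MvPolynomial (Fin 2) ℤ) ^ sorStat σ *
          MvPolynomial.X 1 ^ cycStat σ =
      (MvPolynomial.X 1 + qBracket (k + 1) - 1) ^ (n - k) *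
        ∏ i ∈ Finset.Icc 1 k, (MvPolynomial.X 1 + qBracket i - 1) := by
  have hb : bddS n k = bddP n k n := by
    ext σ
    simp only [bddS, bddP, Finset.mem_filter, Finset.mem_univ, true_and]
    exact ⟨fun h => ⟨h, fun x hx => absurd x.2 (by omega)⟩, fun h => h.1⟩
  have h := bddP_sum n k n le_rfl
  have h0 : (MvPolynomial.X 1 : MvPolynomial (Fin 2) ℤ) ^ n ≠ 0 :=
    pow_ne_zero _ (MvPolynomial.X_ne_zero 1)
  rw [hb, mul_left_cancel₀ h0 h]
  obtain ⟨d, rfl⟩ := Nat.exists_eq_add_of_le hk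
  rw [Finset.prod_range_add, Nat.add_sub_cancel_left, mul_comm]
  congr 1
  · rw [Finset.prod_congr rfl (g := fun _ => MvPolynomial.X 1 + qBracket (k + 1) - 1)]
    · simp
    · intro x _
      rw [min_eq_right (Nat.le_add_right k x)]
  · rw [Finset.range_eq_Ico, ← Finset.Ico_add_one_right_eq_Icc,
      ← Finset.prod_Ico_add' (fun i => MvPolynomial.X 1 + qBracket i - 1) 0 k 1]
    refine Finset.prod_congr rfl fun x hx => ?_
    rw [min_eq_left (Finset.mem_Ico.1 hx).2.le]
end

section
/- Let n ≥ 2 and 0 < k < n. In the group ring ℤ[S_n], define Ψ_{i,k} = 1 + s_i + s_i s_{i−1} + ⋯ + s_i s_{i−1}⋯s_1 for 0 < i < k, and Ψ_{i,k} = 1 + s_i + s_i s_{i−1} + ⋯ + s_i s_{i−1}⋯s_{i+1−k} for k ≤ i ≤ n−1. Then Σ_{w ∈ S(n,k)} w = Ψ_{1,k} Ψ_{2,k} ⋯ Ψ_{n−1,k}. -/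
attribute [local instance] Classical.propDecidable

def bddB (n k j : ℕ) : Finset (Equiv.Perm (Fin n)) :=
  Finset.univ.filter fun π => (∀ i : Fin n, (π i : ℕ) ≤ (i : ℕ) + k) ∧
    ∀ i : Fin n, j ≤ (i : ℕ) → π i = i

def cycP (n j m : ℕ) : Equiv.Perm (Fin n) :=
  ((List.range m).map fun r => transp n (j - r) (j - r + 1)).prod

theorem cycP_apply (n j m : ℕ) (hj : j < n) (hm : m ≤ j) (p : Fin n) :
    ((cycP n j m p : Fin n) : ℕ) =
      if (p : ℕ) = j - m then j else if j - m < (p : ℕ) ∧ (p : ℕ) ≤ j then (p : ℕ) - 1 else p := by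
  induction m generalizing p with
  | zero =>
    simp only [cycP, List.range_zero, List.map_nil, List.prod_nil, Equiv.Perm.one_apply]
    split_ifs <;> omega
  | succ m ih =>
    have hs : cycP n j (m + 1) = cycP n j m * transp n (j - m) (j - m + 1) := by
      simp [cycP, List.range_succ]
    have h : j - m - 1 < n ∧ j - m + 1 - 1 < n := by omega
    rw [hs, Equiv.Perm.mul_apply, ih (by omega)]
    rw [transp, dif_pos h, Equiv.swap_apply_def]
    simp only [Fin.ext_iff]
    by_cases h1 : (p : ℕ) = j - m - 1
    · rw [if_pos h1]; simp only []; split_ifs <;> omega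
    · rw [if_neg h1]
      by_cases h2 : (p : ℕ) = j - m + 1 - 1
      · rw [if_pos h2]; simp only []; split_ifs <;> omega
      · rw [if_neg h2]; split_ifs <;> omega

theorem bddB_step (n k j : ℕ) (hj : j < n) :
    (∑ σ ∈ bddB n k j, MonoidAlgebra.of ℤ (Equiv.Perm (Fin n)) σ) * PsiElt n k j =
      ∑ σ ∈ bddB n k (j + 1), MonoidAlgebra.of ℤ (Equiv.Perm (Fin n)) σ := by
  have hP : PsiElt n k j = ∑ m ∈ Finset.range (min j k + 1),
    MonoidAlgebra.of ℤ (Equiv.Perm (Fin n)) (cycP n j m) := rfl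
  rw [hP, Finset.sum_mul_sum, ← Finset.sum_product']
  refine Finset.sum_bij (fun x _ => x.1 * cycP n j x.2) ?_ ?_ ?_ ?_
  · rintro ⟨σ, m⟩ hx
    simp only [bddB, Finset.mem_product, Finset.mem_filter, Finset.mem_univ, true_and,
      Finset.mem_range] at hx ⊢
    obtain ⟨⟨hb, hf⟩, hm⟩ := hx
    refine ⟨fun p => ?_, fun p hp => ?_⟩
    · rw [Equiv.Perm.mul_apply]
      have hc := cycP_apply n j m hj (by omega) p
      have h1 := hb (cycP n j m p)
      by_cases h : (p : ℕ) = j - m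
      · rw [if_pos h] at hc
        rw [hf _ hc.ge]; omega
      · rw [if_neg h] at hc
        split_ifs at hc <;> omega
    · rw [Equiv.Perm.mul_apply]
      have hc := cycP_apply n j m hj (by omega) p
      have h2 : cycP n j m p = p := by
        apply Fin.ext; split_ifs at hc <;> omega
      rw [h2]; exact hf p (by omega)
  · rintro ⟨σ, m⟩ hx ⟨σ', m'⟩ hx' he
    simp only [bddB, Finset.mem_product, Finset.mem_filter, Finset.mem_univ, true_and,
      Finset.mem_range] at hx hx' he
    obtain ⟨⟨hb, hf⟩, hm⟩ := hx
    obtain ⟨⟨hb', hf'⟩, hm'⟩ := hx'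
    have hmm : m = m' := by
      have e := congrArg (fun τ : Equiv.Perm (Fin n) => τ ⟨j - m, by omega⟩) he
      simp only [Equiv.Perm.mul_apply] at e
      have hc := cycP_apply n j m hj (by omega) ⟨j - m, by omega⟩
      have hc' := cycP_apply n j m' hj (by omega) ⟨j - m, by omega⟩
      simp only [if_true] at hc
      have h1 : cycP n j m ⟨j - m, by omega⟩ = ⟨j, hj⟩ := Fin.ext hc
      have h2 := hf' ⟨j, hj⟩ le_rfl
      rw [h1, hf ⟨j, hj⟩ le_rfl, ← h2] at e
      have h3 := σ'.injective e
      rw [← h3] at hc'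
      simp only [] at hc'
      split_ifs at hc' <;> omega
    subst hmm
    rw [mul_left_inj] at he
    rw [he]
  · intro τ hτ
    simp only [bddB, Finset.mem_filter, Finset.mem_univ, true_and] at hτ
    obtain ⟨hb, hf⟩ := hτ
    obtain ⟨q, hq⟩ := τ.surjective ⟨j, hj⟩
    have hqj : (q : ℕ) ≤ j := by
      by_contra h
      have := hf q (by omega)
      rw [hq] at this
      rw [← this] at h; simp at h
    have hqk := hb q
    rw [hq] at hqk
    simp only [] at hqk
    have hmj : j - (j - (q : ℕ)) = q := by omega
    have hc := fun p => cycP_apply n j (j - q) hj (by omega) p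
    simp only [hmj] at hc
    refine ⟨(τ * (cycP n j (j - q))⁻¹, j - q), ?_, by simp⟩
    simp only [bddB, Finset.mem_product, Finset.mem_filter, Finset.mem_univ, true_and,
      Finset.mem_range]
    have key : ∀ p : Fin n, (τ p : ℕ) ≤ (cycP n j (j - q) p : ℕ) + k ∧
        (j ≤ (cycP n j (j - q) p : ℕ) → τ p = cycP n j (j - q) p) := by
      intro p
      have h1 := hb p
      have h2 := hc p
      by_cases h : (p : ℕ) = q
      · have hp : p = q := Fin.ext h
        rw [if_pos h] at h2
        subst hp
        refine ⟨by rw [hq, h2]; simp, fun _ => ?_⟩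
        rw [hq]; exact Fin.ext h2.symm
      · rw [if_neg h] at h2
        by_cases h' : (q : ℕ) < p ∧ (p : ℕ) ≤ j
        · rw [if_pos h'] at h2
          have h3 : (τ p : ℕ) ≤ j := by
            by_contra h4
            have h5 := hf (τ p) (by omega)
            have h6 := τ.injective h5
            rw [h6] at h4; omega
          exact ⟨by omega, by omega⟩
        · rw [if_neg h'] at h2
          refine ⟨by omega, fun h4 => ?_⟩
          rw [hf p (by omega)]; exact Fin.ext h2.symm
    refine ⟨⟨fun i => ?_, fun i hi => ?_⟩, by omega⟩
    · have := (key ((cycP n j (j - q))⁻¹ i)).1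
      simpa using this
    · have := (key ((cycP n j (j - q))⁻¹ i)).2
      have h0 : cycP n j (j - q) ((cycP n j (j - q))⁻¹ i) = i := by simp
      rw [h0] at this
      exact this hi
  · rintro ⟨σ, m⟩ _
    simp only [map_mul]

theorem bddB_one (n k : ℕ) : bddB n k 1 = {1} := by
  ext σ
  simp only [bddB, Finset.mem_filter, Finset.mem_univ, true_and, Finset.mem_singleton]
  constructor
  · rintro ⟨_, hf⟩
    ext i
    by_cases hi : 1 ≤ (i : ℕ)
    · rw [hf i hi]; rfl
    · by_cases h : 1 ≤ (σ i : ℕ)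
      · have := σ.injective (hf _ h)
        rw [this]; rfl
      · simp only [Equiv.Perm.one_apply]; omega
  · rintro rfl
    simp

theorem bddB_prod (n k j : ℕ) (hj : j < n) :
    (((List.range j).map fun i => PsiElt n k (i + 1)).prod) =
      ∑ σ ∈ bddB n k (j + 1), MonoidAlgebra.of ℤ (Equiv.Perm (Fin n)) σ := by
  induction j with
  | zero => rw [zero_add, bddB_one, Finset.sum_singleton, map_one]; simp
  | succ j ih =>
    rw [List.range_succ, List.map_append, List.prod_append, ih (by omega), List.map_singleton,
      List.prod_singleton, bddB_step n k (j + 1) hj]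

/-- the factorization `Σ_{w ∈ S(n,k)} w = Ψ_{1,k}Ψ_{2,k}⋯Ψ_{n-1,k}`
in the group ring `ℤ[Sₙ]`. -/
theorem stmt5 (n k : ℕ) (hn : 2 ≤ n) (hk0 : 0 < k) (hk : k < n) :
    ∑ σ ∈ bddS n k, MonoidAlgebra.of ℤ (Equiv.Perm (Fin n)) σ =
      (((List.range (n - 1)).map fun i => PsiElt n k (i + 1)).prod) := by
  rw [bddB_prod n k (n - 1) (by omega)]
  congr 1
  ext σ
  simp only [bddS, bddB, Finset.mem_filter, Finset.mem_univ, true_and]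
  exact ⟨fun h => ⟨h, fun i hi => by omega⟩, fun h => h.1⟩
end

section
/- Let n ≥ 2 and 0 < k < n. In the group ring ℤ[S_n], define Φ_{i,k} = 1 + t_{i,i+1} + t_{i−1,i+1} + ⋯ + t_{1,i+1} for 0 < i < k, and Φ_{i,k} = 1 + t_{i,i+1} + t_{i−1,i+1} + ⋯ + t_{i+1−k,i+1} for k ≤ i ≤ n−1. Then Σ_{σ ∈ S(n,k)} σ = Φ_{1,k} Φ_{2,k} ⋯ Φ_{n−1,k}. -/
attribute [local instance] Classical.propDecidable

/-- Elements of `S(n,k)` fixing every position beyond `j` (0-based). -/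
def bddFix (n k j : ℕ) : Finset (Equiv.Perm (Fin n)) :=
  Finset.univ.filter fun π => (∀ i : Fin n, (π i : ℕ) ≤ (i : ℕ) + k) ∧
    ∀ i : Fin n, j < (i : ℕ) → π i = i

theorem transp_eq_swap (n j m : ℕ) (hj : j + 1 < n) :
    transp n (j + 1 + 1 - m) (j + 1 + 1) =
      Equiv.swap (⟨j + 1 - m, by omega⟩ : Fin n) ⟨j + 1, hj⟩ := by
  unfold transp
  rw [dif_pos ⟨by omega, by omega⟩]
  congr 2
  omega

theorem bddFix_mul_swap (n k : ℕ) (J a : Fin n) (haJ : (a : ℕ) ≤ J) (hak : (J : ℕ) ≤ a + k)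
    (τ : Equiv.Perm (Fin n)) (h1 : ∀ i : Fin n, (τ i : ℕ) ≤ (i : ℕ) + k)
    (h2 : ∀ i : Fin n, (J : ℕ) ≤ i → τ i = i) :
    (∀ i : Fin n, ((τ * Equiv.swap a J) i : ℕ) ≤ (i : ℕ) + k) ∧
    ∀ i : Fin n, (J : ℕ) < (i : ℕ) → (τ * Equiv.swap a J) i = i := by
  constructor
  · intro i
    rw [Equiv.Perm.mul_apply]
    by_cases hi : i = a
    · subst hi
      rw [Equiv.swap_apply_left, h2 J le_rfl]; exact hak
    · by_cases hi' : i = J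
      · subst hi'
        rw [Equiv.swap_apply_right]
        have := h1 a
        omega
      · rw [Equiv.swap_apply_of_ne_of_ne hi hi']; exact h1 i
  · intro i hi
    have e1 : i ≠ a := by rintro rfl; omega
    have e2 : i ≠ J := by rintro rfl; omega
    rw [Equiv.Perm.mul_apply, Equiv.swap_apply_of_ne_of_ne e1 e2]
    exact h2 i hi.le

theorem bddFix_le (n : ℕ) (J : Fin n) (σ : Equiv.Perm (Fin n))
    (h2 : ∀ i : Fin n, (J : ℕ) < i → σ i = i) (x : Fin n) (hx : (x : ℕ) ≤ J) :
    (σ x : ℕ) ≤ J := by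
  by_contra h
  push Not at h
  have := σ.injective (h2 (σ x) h)
  rw [this] at h
  omega

theorem bddFix_unswap (n k : ℕ) (J a : Fin n) (σ : Equiv.Perm (Fin n)) (ha : σ a = J)
    (h1 : ∀ i : Fin n, (σ i : ℕ) ≤ (i : ℕ) + k)
    (h2 : ∀ i : Fin n, (J : ℕ) < i → σ i = i) :
    (∀ i : Fin n, ((σ * Equiv.swap a J) i : ℕ) ≤ (i : ℕ) + k) ∧
    ∀ i : Fin n, (J : ℕ) ≤ (i : ℕ) → (σ * Equiv.swap a J) i = i := by
  have haJ : (a : ℕ) ≤ J := by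
    by_contra h
    push Not at h
    have := h2 a h
    rw [ha] at this
    rw [this] at h
    omega
  constructor
  · intro i
    rw [Equiv.Perm.mul_apply]
    by_cases hi : i = a
    · subst hi
      rw [Equiv.swap_apply_left]
      have := bddFix_le n J σ h2 J le_rfl
      have h3 := h1 i
      rw [ha] at h3
      omega
    · by_cases hi' : i = J
      · subst hi'
        rw [Equiv.swap_apply_right, ha]
        omega
      · rw [Equiv.swap_apply_of_ne_of_ne hi hi']; exact h1 i
  · intro i hi
    rw [Equiv.Perm.mul_apply]
    by_cases hi' : i = J
    · subst hi'
      rw [Equiv.swap_apply_right, ha]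
    · have hlt : (J : ℕ) < i := lt_of_le_of_ne hi (fun h => hi' (Fin.ext h.symm))
      have e1 : i ≠ a := by rintro rfl; omega
      rw [Equiv.swap_apply_of_ne_of_ne e1 hi']
      exact h2 i hlt

theorem sum_bddFix_succ (n k j : ℕ) (hj : j + 1 < n) :
    ∑ σ ∈ bddFix n k (j + 1), MonoidAlgebra.of ℤ (Equiv.Perm (Fin n)) σ =
      (∑ σ ∈ bddFix n k j, MonoidAlgebra.of ℤ (Equiv.Perm (Fin n)) σ) *
        PhiElt n k (j + 1) := by
  unfold PhiElt
  rw [Finset.sum_mul_sum, ← Finset.sum_product']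
  symm
  set J : Fin n := ⟨j + 1, hj⟩ with hJ
  have hJv : (J : ℕ) = j + 1 := rfl
  have key : ∀ σ ∈ bddFix n k (j + 1), ((σ⁻¹ J : Fin n) : ℕ) ≤ j + 1 ∧
      j + 1 ≤ ((σ⁻¹ J : Fin n) : ℕ) + k := by
    intro σ hσ
    simp only [bddFix, Finset.mem_filter, Finset.mem_univ, true_and] at hσ
    have ha : σ (σ⁻¹ J) = J := by simp
    constructor
    · by_contra h
      push Not at h
      have := hσ.2 _ h
      rw [ha] at this
      rw [← this] at h
      omega
    · have := hσ.1 (σ⁻¹ J)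
      rw [ha] at this
      exact this
  refine Finset.sum_bij'
    (fun p _ => p.1 * Equiv.swap (⟨j + 1 - p.2, by omega⟩ : Fin n) J)
    (fun σ _ => (σ * Equiv.swap (σ⁻¹ J) J, j + 1 - ((σ⁻¹ J : Fin n) : ℕ))) ?_ ?_ ?_ ?_ ?_
  · rintro ⟨τ, m⟩ hp
    simp only [bddFix, Finset.mem_product, Finset.mem_filter, Finset.mem_univ, true_and,
      Finset.mem_range] at hp ⊢
    obtain ⟨⟨h1, h2⟩, hm⟩ := hp
    exact bddFix_mul_swap n k J _ (by simp only; omega) (by simp only; omega) τ h1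
      (fun i hi => h2 i (by omega))
  · intro σ hσ
    have hk := key σ hσ
    simp only [bddFix, Finset.mem_product, Finset.mem_filter, Finset.mem_univ, true_and,
      Finset.mem_range] at hσ ⊢
    have := bddFix_unswap n k J (σ⁻¹ J) σ (by simp) hσ.1 hσ.2
    exact ⟨⟨this.1, fun i hi => this.2 i (by omega)⟩, by omega⟩
  · rintro ⟨τ, m⟩ hp
    simp only [bddFix, Finset.mem_product, Finset.mem_filter, Finset.mem_univ, true_and,
      Finset.mem_range] at hp ⊢
    obtain ⟨⟨h1, h2⟩, hm⟩ := hp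
    have hτ : τ J = J := h2 J (by omega)
    have e : (τ * Equiv.swap (⟨j + 1 - m, by omega⟩ : Fin n) J)⁻¹ J = ⟨j + 1 - m, by omega⟩ := by
      rw [Equiv.Perm.inv_eq_iff_eq, Equiv.Perm.mul_apply, Equiv.swap_apply_left, hτ]
    rw [e]
    ext1
    · simp [mul_assoc]
    · simp only; omega
  · intro σ hσ
    have hk := key σ hσ
    have e : (⟨j + 1 - (j + 1 - ((σ⁻¹ J : Fin n) : ℕ)), by omega⟩ : Fin n) = σ⁻¹ J := by
      apply Fin.ext
      simp only
      omega
    simp only [e]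
    simp [mul_assoc]
  · rintro ⟨τ, m⟩ hp
    simp only
    rw [transp_eq_swap n j m hj, map_mul]

theorem sum_bddFix (n k j : ℕ) (hj : j < n) :
    ∑ σ ∈ bddFix n k j, MonoidAlgebra.of ℤ (Equiv.Perm (Fin n)) σ =
      (((List.range j).map fun i => PhiElt n k (i + 1)).prod) := by
  induction j with
  | zero =>
    have : bddFix n k 0 = {1} := by
      ext σ
      simp only [bddFix, Finset.mem_filter, Finset.mem_univ, true_and, Finset.mem_singleton]
      constructor
      · rintro ⟨-, h2⟩
        ext i
        by_cases hi : 0 < (i : ℕ)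
        · rw [h2 i hi]; rfl
        · have := bddFix_le n ⟨0, hj⟩ σ h2 i (by simp only; omega)
          simp only at this
          rw [Equiv.Perm.one_apply]
          omega
      · rintro rfl
        simp
    rw [this, Finset.sum_singleton, map_one]
    simp
  | succ j ih =>
    rw [sum_bddFix_succ n k j hj, ih (by omega), List.range_succ, List.map_append,
      List.prod_append]
    simp

/-- the factorization `Σ_{σ ∈ S(n,k)} σ = Φ_{1,k}Φ_{2,k}⋯Φ_{n-1,k}`
in the group ring `ℤ[Sₙ]`. -/
theorem stmt6 (n k : ℕ) (hn : 2 ≤ n) (hk0 : 0 < k) (hk : k < n) :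
    ∑ σ ∈ bddS n k, MonoidAlgebra.of ℤ (Equiv.Perm (Fin n)) σ =
      (((List.range (n - 1)).map fun i => PhiElt n k (i + 1)).prod) := by
  have h : bddS n k = bddFix n k (n - 1) := by
    unfold bddS bddFix
    ext σ
    simp only [Finset.mem_filter, Finset.mem_univ, true_and]
    exact ⟨fun h => ⟨h, fun i hi => absurd i.isLt (by omega)⟩, fun h => h.1⟩
  rw [h]
  exact sum_bddFix n k (n - 1) (by omega)
end

section
/- For every 213-avoiding permutation π ∈ S_n with n ≥ 1, one has maxdrop(π) = n − π_n, where π_n is the last entry of π. -/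
attribute [local instance] Classical.propDecidable

/-- for a 213-avoiding permutation, `maxdrop π = n - π_n`
(0-indexed: `maxdrop π = (n-1) - π(n-1)`). -/
theorem stmt9 (n : ℕ) (hn : 1 ≤ n) (π : Equiv.Perm (Fin n)) (h : avoids213 π) :
    maxdrop π = n - 1 - (π ⟨n - 1, by omega⟩ : ℕ) := by
  unfold maxdrop
  apply le_antisymm
  · apply Finset.sup_le
    intro i _
    set L : Fin n := ⟨n - 1, by omega⟩ with hL
    have hLv : (L : ℕ) = n - 1 := rfl
    have hi := i.isLt
    have hpL := (π L).isLt
    by_cases hle : π L ≤ π i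
    · have : (π L : ℕ) ≤ (π i : ℕ) := hle
      omega
    · have hlt : π i < π L := not_le.mp hle
      have hiL : i < L := by
        rcases lt_trichotomy i L with h1 | h1 | h1
        · exact h1
        · rw [h1] at hlt
          exact absurd hlt (lt_irrefl _)
        · have : (L : ℕ) < i := h1
          omega
      have hsub : (Finset.Iio i).map π.toEmbedding ⊆ Finset.Iio (π i) ∪ Finset.Ioi (π L) := by
        intro x hx
        obtain ⟨j, hj, rfl⟩ := Finset.mem_map.mp hx
        have hji : j < i := Finset.mem_Iio.mp hj
        simp only [Finset.mem_union, Finset.mem_Iio, Finset.mem_Ioi, Equiv.coe_toEmbedding]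
        by_contra hc
        have h1 : π i ≤ π j := not_lt.mp fun h' => hc (Or.inl h')
        have h2 : π j ≤ π L := not_lt.mp fun h' => hc (Or.inr h')
        apply h
        refine ⟨j, i, L, hji, hiL, lt_of_le_of_ne h1 ?_, lt_of_le_of_ne h2 ?_⟩
        · intro e
          exact hji.ne (π.injective e).symm
        · intro e
          exact (hji.trans hiL).ne (π.injective e)
      have hc := (Finset.card_le_card hsub).trans (Finset.card_union_le _ _)
      rw [Finset.card_map, Fin.card_Iio, Fin.card_Iio, Fin.card_Ioi] at hc
      omega
  · exact Finset.le_sup (f := fun i : Fin n => (i : ℕ) - (π i : ℕ)) (Finset.mem_univ ⟨n - 1, by omega⟩)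
end
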